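/- arXiv:1011.5652 — 3 statements merged into one kernel-verified Lean document; each statement's English description precedes it below -/
import Mathlib

section
/- Let r be an odd positive integer and x, y integers with gcd(r, x) = 1, and let x* be an integer with x·x* ≡ 1 (mod r). Set e_r = exp(2πi/r) ∈ ℂ. Then the generalized Gauss sum satisfies ∑_{j=0}^{r−1} e_r^{x j² + y j} = ε(r) · (x / r) · √r · e_r^{−x*·y²·((r+1)/2)²}, where (x / r) denotes the Jacobi symbol. (The right-hand side does not depend on the choice of x*.) -/
open Finset

/-- The Gaussian binomial coefficient `[m choose j]_q`, defined by the Pascal recursion. -/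
def gaussBinom {R : Type*} [CommRing R] (q : R) : ℕ → ℕ → R
  | _, 0 => 1
  | 0, _ + 1 => 0
  | m + 1, j + 1 => gaussBinom q m j + q ^ (j + 1) * gaussBinom q m (j + 1)

namespace gaussBinom

variable {R : Type*} [CommRing R] (q : R)

@[simp] lemma zero_right (m : ℕ) : gaussBinom q m 0 = 1 := by cases m <;> rfl

@[simp] lemma zero_succ (j : ℕ) : gaussBinom q 0 (j + 1) = 0 := rfl

lemma succ_succ (m j : ℕ) : gaussBinom q (m + 1) (j + 1) =
    gaussBinom q m j + q ^ (j + 1) * gaussBinom q m (j + 1) := rfl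

lemma eq_zero_of_lt (m j : ℕ) (h : m < j) : gaussBinom q m j = 0 := by
  induction m generalizing j with
  | zero => obtain ⟨j, rfl⟩ := Nat.exists_eq_succ_of_ne_zero h.ne'; rfl
  | succ m ih =>
    obtain ⟨j, rfl⟩ := Nat.exists_eq_succ_of_ne_zero (Nat.ne_zero_of_lt h)
    rw [Nat.succ_eq_add_one, succ_succ, ih j (by omega), ih (j + 1) (by omega)]
    simp

lemma absorption (m j : ℕ) : (1 - q ^ (j + 1)) * gaussBinom q (m + 1) (j + 1) =
    (1 - q ^ (m + 1)) * gaussBinom q m j := by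
  induction m generalizing j with
  | zero =>
    cases j <;> simp [succ_succ]
  | succ m ih =>
    rw [succ_succ q (m + 1)]
    cases j with
    | zero =>
      have := ih 0
      simp only [zero_right, zero_add] at this ⊢
      linear_combination q * this
    | succ j =>
      have h1 := ih j
      have h2 := ih (j + 1)
      have h3 := succ_succ q m j
      linear_combination q ^ (j + 2) * h2 + q * h1 - q * (1 - q ^ (m + 1)) * h3

/-- **Gauss**: the alternating sum of a row of Gaussian binomial coefficients. -/
lemma alternating_sum_succ_succ (m : ℕ) :
    ∑ j ∈ range (m + 3), (-1) ^ j * gaussBinom q (m + 2) j =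
      (1 - q ^ (m + 1)) * ∑ j ∈ range (m + 1), (-1) ^ j * gaussBinom q m j := by
  have h1 : ∑ j ∈ range (m + 3), (-1) ^ j * gaussBinom q (m + 2) j =
      1 + ∑ j ∈ range (m + 2), (-1) ^ (j + 1) * (gaussBinom q (m + 1) j +
        q ^ (j + 1) * gaussBinom q (m + 1) (j + 1)) := by
    rw [sum_range_succ']
    simp [succ_succ, add_comm]
  have h2 : ∑ j ∈ range (m + 2), (-1) ^ (j + 1) * gaussBinom q (m + 1) (j + 1) =
      ∑ j ∈ range (m + 2), (-1) ^ j * gaussBinom q (m + 1) j - 1 := by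
    rw [eq_sub_iff_add_eq]
    have := sum_range_succ' (fun j ↦ (-1) ^ j * gaussBinom q (m + 1) j) (m + 2)
    rw [sum_range_succ] at this
    simpa [eq_zero_of_lt q (m + 1) (m + 2) (by omega)] using this.symm
  have h3 : ∑ j ∈ range (m + 2), (-1) ^ j * gaussBinom q m j =
      ∑ j ∈ range (m + 1), (-1) ^ j * gaussBinom q m j := by
    rw [sum_range_succ]
    simp [eq_zero_of_lt q m (m + 1) (by omega)]
  have h4 : ∑ j ∈ range (m + 2), (-1) ^ (j + 1) * (gaussBinom q (m + 1) j +
        q ^ (j + 1) * gaussBinom q (m + 1) (j + 1)) =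
      ∑ j ∈ range (m + 2), (-1) ^ (j + 1) * gaussBinom q (m + 1) (j + 1) -
      ∑ j ∈ range (m + 2), (-1) ^ j * gaussBinom q (m + 1) j +
      (1 - q ^ (m + 1)) * ∑ j ∈ range (m + 2), (-1) ^ j * gaussBinom q m j := by
    rw [mul_sum, ← sum_sub_distrib, ← sum_add_distrib]
    refine sum_congr rfl fun j _ ↦ ?_
    linear_combination (-1) ^ j * absorption q m j
  rw [h1, h4, h2, h3]
  ring

lemma alternating_sum_two_mul (m : ℕ) :
    ∑ j ∈ range (2 * m + 1), (-1) ^ j * gaussBinom q (2 * m) j =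
      ∏ i ∈ range m, (1 - q ^ (2 * i + 1)) := by
  induction m with
  | zero => simp
  | succ m ih =>
    rw [prod_range_succ, ← ih, mul_comm _ (1 - _), ← alternating_sum_succ_succ]
    rfl

lemma pow_mul_eq_of_pow_eq_one {K : Type*} [Field K] {q : K} {m : ℕ}
    (hq : IsPrimitiveRoot q (m + 1)) {j : ℕ} (hj : j ≤ m) :
    (-1) ^ j * gaussBinom q m j = q⁻¹ ^ (∑ i ∈ range (j + 1), i) := by
  have hq0 : q ≠ 0 := hq.ne_zero (by omega)
  induction j with
  | zero => simp
  | succ j ih =>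
    have h1 : 1 - q ^ (j + 1) ≠ 0 :=
      sub_ne_zero.2 (hq.pow_ne_one_of_pos_of_lt (by omega) (by omega)).symm
    have h2 := absorption q m j
    rw [hq.pow_eq_one, succ_succ] at h2
    have h3 : gaussBinom q m j + q ^ (j + 1) * gaussBinom q m (j + 1) = 0 := by
      apply mul_left_cancel₀ h1
      rw [h2]; ring
    rw [sum_range_succ, pow_add q⁻¹, ← ih (by omega), inv_pow,
      eq_mul_inv_iff_mul_eq₀ (pow_ne_zero _ hq0)]
    linear_combination (-1) ^ (j + 1) * h3

end gaussBinom

lemma IsPrimitiveRoot.sum_pow_mul_succ_eq_prod {K : Type*} [Field K] {ζ : K} {m : ℕ}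
    (hζ : IsPrimitiveRoot ζ (2 * m + 1)) :
    ζ ^ (m + 1) ^ 2 * ∑ j ∈ range (2 * m + 1), ζ ^ (j * (j + 1)) =
      ∏ i ∈ range m, (ζ ^ (2 * i + 1) - ζ⁻¹ ^ (2 * i + 1)) := by
  have hζ0 : ζ ≠ 0 := hζ.ne_zero (by omega)
  have hq : IsPrimitiveRoot (ζ⁻¹ ^ 2) (2 * m + 1) :=
    hζ.inv.pow_of_coprime 2 (by simp)
  have h1 : ∑ j ∈ range (2 * m + 1), ζ ^ (j * (j + 1)) =
      ∏ i ∈ range m, (1 - (ζ⁻¹ ^ 2) ^ (2 * i + 1)) := by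
    rw [← gaussBinom.alternating_sum_two_mul]
    refine sum_congr rfl fun j hj ↦ ?_
    rw [gaussBinom.pow_mul_eq_of_pow_eq_one hq (by simp at hj; omega), ← inv_pow, inv_inv,
      ← pow_mul]
    have := sum_range_id_mul_two (j + 1)
    congr 1
    simp only [add_tsub_cancel_right] at this
    linarith
  have h2 : ∀ k, ζ ^ k ^ 2 = ∏ i ∈ range k, ζ ^ (2 * i + 1) := fun k ↦ by
    induction k with
    | zero => simp
    | succ k ih => rw [prod_range_succ, ← ih, ← pow_add]; congr 1; ring
  have h3 : ζ ^ (m + 1) ^ 2 = ζ ^ m ^ 2 := by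
    rw [show (m + 1) ^ 2 = m ^ 2 + (2 * m + 1) by ring, pow_add, hζ.pow_eq_one, mul_one]
  rw [h1, h3, h2, ← prod_mul_distrib]
  refine prod_congr rfl fun i _ ↦ ?_
  have : ζ ^ (2 * i + 1) * ζ⁻¹ ^ (2 * i + 1) = 1 := by rw [← mul_pow, mul_inv_cancel₀ hζ0, one_pow]
  linear_combination -ζ⁻¹ ^ (2 * i + 1) * this

lemma exp_root_zpow (n : ℕ) [NeZero n] (k : ℤ) :
    Complex.exp (2 * (Real.pi : ℂ) * Complex.I / n) ^ k = ZMod.stdAddChar (k : ZMod n) := by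
  rw [ZMod.stdAddChar_coe, ← Complex.exp_int_mul]
  congr 1
  ring

lemma ZMod.sum_range_natCast {M : Type*} [AddCommMonoid M] (n : ℕ) [NeZero n] (f : ZMod n → M) :
    ∑ j ∈ range n, f (j : ZMod n) = ∑ j : ZMod n, f j :=
  sum_nbij' (fun j ↦ (j : ZMod n)) ZMod.val (by simp) (by simp [ZMod.val_lt])
    (fun j hj ↦ ZMod.val_cast_of_lt (by simpa using hj)) (by simp) (by simp)

/-- The quadratic Gauss sum `∑ j, exp (2πi a j² / n)` over `ZMod n`. -/
noncomputable def quadGaussSum (n : ℕ) [NeZero n] (a : ZMod n) : ℂ :=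
  ∑ j : ZMod n, ZMod.stdAddChar (a * j ^ 2)

lemma norm_quadGaussSum_one {n : ℕ} [NeZero n] (hn : Odd n) : ‖quadGaussSum n 1‖ = √n := by
  have h2 : IsUnit (2 : ZMod n) := by
    have := (ZMod.isUnit_iff_coprime 2 n).2 (by simpa using hn)
    simpa using this
  have key : (starRingEnd ℂ) (quadGaussSum n 1) * quadGaussSum n 1 = n := by
    simp only [quadGaussSum, one_mul, map_sum, sum_mul_sum]
    calc _ = ∑ l : ZMod n, ∑ d : ZMod n, (ZMod.stdAddChar (d ^ 2) : ℂ) *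
          ZMod.stdAddChar (l * (2 * d)) := by
          refine sum_congr rfl fun l _ ↦ ?_
          rw [← Equiv.sum_comp (Equiv.addLeft l)]
          refine sum_congr rfl fun d _ ↦ ?_
          rw [Equiv.coe_addLeft, ← AddChar.map_neg_eq_conj, ← AddChar.map_add_eq_mul,
            ← AddChar.map_add_eq_mul]
          congr 1
          ring
      _ = n := by
          rw [sum_comm]
          simp_rw [← mul_sum, AddChar.sum_mulShift _ (ZMod.isPrimitive_stdAddChar n),
            h2.mul_right_eq_zero]
          simp
  rw [Complex.conj_mul'] at key
  rw [← Real.sqrt_sq (norm_nonneg _)]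
  congr 1
  exact_mod_cast key

lemma quadGaussSum_one_eq_prod {m : ℕ} : quadGaussSum (2 * m + 1) 1 = ∏ i ∈ range m,
    ((2 * Real.sin (2 * Real.pi * (2 * i + 1) / (2 * m + 1)) : ℝ) * Complex.I) := by
  have hζ := Complex.isPrimitiveRoot_exp (2 * m + 1) (by omega)
  have h1 := hζ.sum_pow_mul_succ_eq_prod
  have h2 : quadGaussSum (2 * m + 1) 1 = Complex.exp (2 * Real.pi * Complex.I / (2 * m + 1 : ℕ)) ^
      (m + 1) ^ 2 * ∑ j ∈ range (2 * m + 1),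
        Complex.exp (2 * Real.pi * Complex.I / (2 * m + 1 : ℕ)) ^ (j * (j + 1)) := by
    have : ∀ k : ℕ, Complex.exp (2 * Real.pi * Complex.I / (2 * m + 1 : ℕ)) ^ k =
        ZMod.stdAddChar (k : ZMod (2 * m + 1)) := fun k ↦ by
      simpa using exp_root_zpow (2 * m + 1) k
    simp_rw [this]
    push_cast
    rw [ZMod.sum_range_natCast (2 * m + 1) fun j ↦ (ZMod.stdAddChar (j * (j + 1)) : ℂ), mul_sum,
      quadGaussSum, ← Equiv.sum_comp (Equiv.addRight (m + 1 : ZMod (2 * m + 1)))]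
    refine sum_congr rfl fun j _ ↦ ?_
    rw [← AddChar.map_add_eq_mul, Equiv.coe_addRight]
    congr 1
    have h0 : (2 * m + 1 : ZMod (2 * m + 1)) = 0 := by
      exact_mod_cast ZMod.natCast_self (2 * m + 1)
    linear_combination j * h0
  rw [h2, h1]
  refine prod_congr rfl fun i _ ↦ ?_
  rw [← Complex.exp_neg, ← Complex.exp_nat_mul, ← Complex.exp_nat_mul]
  push_cast
  rw [Complex.two_sin, mul_assoc _ Complex.I, Complex.I_mul_I,
    show -(2 * Real.pi * (2 * i + 1) / (2 * m + 1) : ℂ) * Complex.I =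
    (2 * i + 1) * -(2 * Real.pi * Complex.I / (2 * m + 1)) by ring,
    show (2 * Real.pi * (2 * i + 1) / (2 * m + 1) : ℂ) * Complex.I =
    (2 * i + 1) * (2 * Real.pi * Complex.I / (2 * m + 1)) by ring, mul_neg]
  ring

theorem quadGaussSum_one {n : ℕ} [NeZero n] (hn : Odd n) :
    quadGaussSum n 1 = (if n % 4 = 1 then 1 else Complex.I) * (√n : ℝ) := by
  obtain ⟨m, rfl⟩ := hn
  have hnorm := norm_quadGaussSum_one (n := 2 * m + 1) ⟨m, rfl⟩
  set s : ℕ → ℝ := fun i ↦ 2 * Real.sin (2 * Real.pi * (2 * i + 1) / (2 * m + 1))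
  have hprod : quadGaussSum (2 * m + 1) 1 = ∏ i ∈ range m, ((s i : ℝ) * Complex.I) :=
    quadGaussSum_one_eq_prod
  have hm0 : (0 : ℝ) < 2 * m + 1 := by positivity
  have hpos : ∀ i, 2 * (2 * i + 1) < 2 * m + 1 → 0 < s i := fun i hi ↦ by
    have hi : (2 * (2 * i + 1) : ℝ) < 2 * m + 1 := by exact_mod_cast hi
    refine mul_pos two_pos (Real.sin_pos_of_pos_of_lt_pi (by positivity) ?_)
    rw [div_lt_iff₀ hm0]
    nlinarith [Real.pi_pos]
  have hneg : ∀ i, i < m → 2 * m + 1 < 2 * (2 * i + 1) → s i < 0 := fun i him hi ↦ by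
    have hi : (2 * m + 1 : ℝ) < 2 * (2 * i + 1) := by exact_mod_cast hi
    have him : (i + 1 : ℝ) ≤ m := by exact_mod_cast him
    have : Real.sin (2 * Real.pi * (2 * i + 1) / (2 * m + 1) - 2 * Real.pi) < 0 := by
      refine Real.sin_neg_of_neg_of_neg_pi_lt ?_ ?_
      · rw [sub_neg, div_lt_iff₀ hm0]
        nlinarith [Real.pi_pos]
      · rw [lt_sub_iff_add_lt, lt_div_iff₀ hm0]
        nlinarith [Real.pi_pos]
    rw [Real.sin_sub_two_pi] at this
    simp only [s]
    linarith
  have hc : ∃ c : ℝ, 0 < c ∧ quadGaussSum (2 * m + 1) 1 =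
      (if (2 * m + 1) % 4 = 1 then 1 else Complex.I) * c := by
    obtain ⟨t, e, he, rfl⟩ : ∃ t e, e < 2 ∧ m = t + e + t :=
      ⟨m / 2, m % 2, Nat.mod_lt _ two_pos, by omega⟩
    refine ⟨(∏ i ∈ range (t + e), s i) * ∏ i ∈ range t, -s (t + e + i), mul_pos
      (prod_pos fun i hi ↦ hpos i (by simp at hi; omega))
      (prod_pos fun i hi ↦ neg_pos.2 <|
        hneg _ (by simp at hi; omega) (by simp at hi; omega)), ?_⟩
    have h1 : ∀ i, (s (t + e + i) : ℂ) * Complex.I = (-s (t + e + i)) * (-Complex.I) :=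
      fun i ↦ by ring
    rw [hprod, prod_range_add, prod_mul_distrib]
    simp_rw [h1]
    rw [prod_mul_distrib, prod_const, prod_const, card_range, card_range, pow_add]
    have h2 : Complex.I ^ t * (-Complex.I) ^ t = 1 := by simp [← mul_pow]
    have h3 : (if (2 * (t + e + t) + 1) % 4 = 1 then 1 else Complex.I) = Complex.I ^ e := by
      interval_cases e
      · rw [if_pos (by omega), pow_zero]
      · rw [if_neg (by omega), pow_one]
    rw [h3]
    push_cast
    linear_combination (∏ i ∈ range (t + e), (s i : ℂ)) *
      (∏ i ∈ range t, -(s (t + e + i) : ℂ)) * Complex.I ^ e * h2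
  obtain ⟨c, hc0, hc⟩ := hc
  have : c = √(2 * m + 1 : ℕ) := by
    rw [← hnorm, hc]
    split_ifs <;> simp [abs_of_pos hc0]
  rw [hc, this]

lemma quadGaussSum_mul {m n : ℕ} [NeZero m] [NeZero n] (h : m.Coprime n) :
    quadGaussSum (m * n) 1 = quadGaussSum m n * quadGaussSum n m := by
  let φ : ZMod m × ZMod n → ZMod (m * n) := fun p ↦ n * p.1.val + m * p.2.val
  have hφ : φ.Bijective := by
    rw [Fintype.bijective_iff_injective_and_card]
    refine ⟨?_, by simp [ZMod.card]⟩
    rintro ⟨u, v⟩ ⟨u', v'⟩ huv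
    have h1 := congrArg (ZMod.castHom (Dvd.intro n rfl : m ∣ m * n) (ZMod m)) huv
    have h2 := congrArg (ZMod.castHom (Dvd.intro_left m rfl : n ∣ m * n) (ZMod n)) huv
    simp only [φ, map_add, map_mul, map_natCast, ZMod.natCast_self, zero_mul, add_zero, zero_add,
      ZMod.natCast_zmod_val] at h1 h2
    have hm : IsUnit (m : ZMod n) := (ZMod.isUnit_iff_coprime m n).2 h
    have hn : IsUnit (n : ZMod m) := (ZMod.isUnit_iff_coprime n m).2 h.symm
    exact Prod.ext (hn.mul_left_cancel h1) (hm.mul_left_cancel h2)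
  rw [quadGaussSum, ← hφ.sum_comp, Fintype.sum_prod_type, quadGaussSum, quadGaussSum, sum_mul_sum]
  refine sum_congr rfl fun u _ ↦ sum_congr rfl fun v _ ↦ ?_
  have hu : (n : ZMod m) * u ^ 2 = ((n * u.val ^ 2 : ℤ) : ZMod m) := by simp
  have hv : (m : ZMod n) * v ^ 2 = ((m * v.val ^ 2 : ℤ) : ZMod n) := by simp
  have huv : 1 * φ (u, v) ^ 2 = ((n ^ 2 * u.val ^ 2 + m ^ 2 * v.val ^ 2 : ℤ) : ZMod (m * n)) := by
    have : (m * n : ZMod (m * n)) = 0 := by exact_mod_cast ZMod.natCast_self (m * n)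
    simp only [φ]
    push_cast
    linear_combination (2 * u.val * v.val : ZMod (m * n)) * this
  rw [hu, hv, huv, ZMod.stdAddChar_coe, ZMod.stdAddChar_coe, ZMod.stdAddChar_coe, ← Complex.exp_add]
  congr 1
  have hm0 : (m : ℂ) ≠ 0 := NeZero.ne _
  have hn0 : (n : ℂ) ≠ 0 := NeZero.ne _
  push_cast
  field_simp

lemma quadGaussSum_prime {p : ℕ} [Fact p.Prime] (hp : p ≠ 2) {a : ZMod p} (ha : a ≠ 0) :
    quadGaussSum p a = quadraticChar (ZMod p) a * quadGaussSum p 1 := by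
  have key : ∀ b : ZMod p, b ≠ 0 → quadGaussSum p b =
      ∑ x : ZMod p, (quadraticChar (ZMod p) x : ℂ) * ZMod.stdAddChar (b * x) := fun b hb ↦ by
    have h0 : ∑ x : ZMod p, (ZMod.stdAddChar (b * x) : ℂ) = 0 := by
      simp_rw [mul_comm b]
      rw [AddChar.sum_mulShift _ (ZMod.isPrimitive_stdAddChar p), if_neg hb]
      simp
    have h1 : quadGaussSum p b = ∑ x : ZMod p,
        ((quadraticChar (ZMod p) x + 1 : ℤ) : ℂ) * ZMod.stdAddChar (b * x) := by
      rw [quadGaussSum, ← sum_fiberwise (s := univ) (g := fun j : ZMod p ↦ j ^ 2)]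
      refine sum_congr rfl fun x _ ↦ ?_
      rw [← quadraticChar_card_sqrts (by rwa [ZMod.ringChar_zmod_n]) x, Set.toFinset_ofPred,
        sum_congr rfl (g := fun _ ↦ (ZMod.stdAddChar (b * x) : ℂ))]
      · simp
      · simp +contextual
    rw [h1]
    push_cast
    simp_rw [add_mul, one_mul]
    rw [sum_add_distrib, h0, add_zero]
  rw [key a ha, key 1 one_ne_zero, ← Equiv.sum_comp (Equiv.mulLeft₀ a ha)
    (fun x ↦ _ * ZMod.stdAddChar (1 * x)), mul_sum]
  refine sum_congr rfl fun x _ ↦ ?_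
  have : (quadraticChar (ZMod p) a : ℂ) * quadraticChar (ZMod p) a = 1 := by
    exact_mod_cast (sq _).symm.trans (quadraticChar_sq_one ha)
  simp only [Equiv.mulLeft₀_apply, map_mul, one_mul, Int.cast_mul]
  linear_combination (-(quadraticChar (ZMod p) x : ℂ) * ZMod.stdAddChar (a * x)) * this

theorem quadGaussSum_eq {n : ℕ} [NeZero n] (hn : Odd n) {a : ℤ} (ha : IsCoprime a n) :
    quadGaussSum n a = (if n % 4 = 1 then 1 else Complex.I) * jacobiSym a n * (√n : ℝ) := by
  obtain ⟨p, hpn, hp, hpa⟩ := Nat.forall_exists_prime_gt_and_zmodEq (max n 2) (NeZero.ne n) ha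
  have hp2 : 2 < p := (le_max_right _ _).trans_lt hpn
  have hpn : n < p := (le_max_left _ _).trans_lt hpn
  have : Fact p.Prime := ⟨hp⟩
  have hpodd : Odd p := hp.odd_of_ne_two hp2.ne'
  have hcop : n.Coprime p := (Nat.coprime_of_lt_prime (NeZero.ne n) hpn hp).symm
  have h1 := quadGaussSum_mul hcop
  have hn0 : (n : ZMod p) ≠ 0 := ((ZMod.isUnit_iff_coprime n p).2 hcop).ne_zero
  have hχ : quadraticChar (ZMod p) n = jacobiSym n p := by
    rw [← jacobiSym.legendreSym.to_jacobiSym, legendreSym, Int.cast_natCast]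
  have ha' : (a : ZMod n) = (p : ℕ) := by
    exact_mod_cast ((ZMod.intCast_eq_intCast_iff _ _ _).2 hpa).symm
  rw [quadGaussSum_prime hp2.ne' hn0, hχ, quadGaussSum_one hpodd,
    quadGaussSum_one (hn.mul hpodd), ← ha', Nat.cast_mul, Real.sqrt_mul (by positivity)] at h1
  rw [← jacobiSym.mod_left' hpa]
  have hJ : (jacobiSym n p : ℂ) ^ 2 = 1 := by
    exact_mod_cast jacobiSym.sq_one (a := n) (b := p) (by simpa using hcop)
  have hp0 : ((√p : ℝ) : ℂ) ≠ 0 := by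
    simpa using hp.ne_zero
  have hnz : (jacobiSym n p : ℂ) ≠ 0 := fun h ↦ by simp [h] at hJ
  have hQ := jacobiSym.quadratic_reciprocity_if (Nat.odd_iff.1 hpodd) (Nat.odd_iff.1 hn)
  rw [← hQ]
  rcases Nat.odd_mod_four_iff.1 (Nat.odd_iff.1 hn) with h4 | h4 <;>
  rcases Nat.odd_mod_four_iff.1 (Nat.odd_iff.1 hpodd) with h4' | h4' <;>
  · simp only [Nat.mul_mod n p 4, h4, h4'] at h1 ⊢
    norm_num at h1 ⊢
    refine mul_right_cancel₀ hp0 (mul_right_cancel₀ hnz ?_)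
    grind [Complex.I_sq]

theorem stmt_16 (r : ℕ) (hr : 0 < r) (hrodd : Odd r) (x y xstar : ℤ)
    (hcop : Int.gcd (r : ℤ) x = 1) (hstar : x * xstar ≡ 1 [ZMOD (r : ℤ)]) :
    ∑ j ∈ Finset.range r,
        Complex.exp (2 * (Real.pi : ℂ) * Complex.I / r) ^ (x * (j : ℤ) ^ 2 + y * (j : ℤ)) =
      (if r % 4 = 1 then (1 : ℂ) else Complex.I) * (jacobiSym x r : ℂ) *
        (Real.sqrt r : ℂ) *
        Complex.exp (2 * (Real.pi : ℂ) * Complex.I / r) ^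
          (-(xstar * y ^ 2 * (((r : ℤ) + 1) / 2) ^ 2)) := by
  have : NeZero r := ⟨hr.ne'⟩
  have hxs : (x * xstar : ZMod r) = 1 := by
    exact_mod_cast (ZMod.intCast_eq_intCast_iff _ _ _).2 hstar
  set h : ℤ := ((r : ℤ) + 1) / 2 with hh
  have h2 : (2 * h : ZMod r) = 1 := by
    have : 2 * h = r + 1 := by obtain ⟨k, hk⟩ := hrodd; omega
    have := congrArg (Int.cast : ℤ → ZMod r) this
    simpa using this
  rw [← quadGaussSum_eq hrodd (Int.isCoprime_iff_gcd_eq_one.2 (Int.gcd_comm _ _ ▸ hcop))]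
  simp_rw [exp_root_zpow]
  push_cast
  rw [ZMod.sum_range_natCast r fun j ↦ (ZMod.stdAddChar (x * j ^ 2 + y * j : ZMod r) : ℂ),
    quadGaussSum, 
    ← Equiv.sum_comp (Equiv.addRight (xstar * y * h : ZMod r))
      (fun j ↦ (ZMod.stdAddChar (x * j ^ 2 : ZMod r) : ℂ)), sum_mul]
  refine sum_congr rfl fun j _ ↦ ?_
  rw [← AddChar.map_add_eq_mul, Equiv.coe_addRight]
  congr 1
  linear_combination (-(2 * j * y * h) - xstar * y ^ 2 * h ^ 2) * hxs - j * y * h2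
end

section
/- Let r be an odd positive integer, ξ ∈ ℂ a primitive r-th root of unity, and b a nonzero integer. Set c = gcd(b, r), let γ = ∑_{n odd, 0 ≤ n ≤ 2r−1} ξ^{b(n²−1)/4}, and when c = 1 let β be an integer with β·b ≡ 1 (mod r). Then ∑_{n odd, 0 ≤ n ≤ 2r−1} ξ^{b(n²−1)/4}·(ξ^n + ξ^{−n} − 2) = −2γ·(1 − ξ^{−β}) if c = 1, and = −2γ if c > 1. -/
open Finset

theorem sum_filter_odd_range_two_mul {M : Type*} [AddCommMonoid M] (f : ℕ → M) (r : ℕ) :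
    ∑ n ∈ (Finset.range (2 * r)).filter (fun n => Odd n), f n =
      ∑ m ∈ Finset.range r, f (2 * m + 1) := by
  induction r with
  | zero => simp
  | succ k ih =>
    rw [Finset.sum_range_succ, ← ih, Finset.sum_filter, Finset.sum_filter,
      show 2 * (k + 1) = 2 * k + 1 + 1 by ring, Finset.sum_range_succ, Finset.sum_range_succ,
      if_neg (by simp), if_pos (by simp), add_zero]

theorem sum_range_add_int_of_periodic {M : Type*} [AddCommGroup M] (f : ℤ → M) (r : ℕ)
    (hf : Function.Periodic f (r : ℤ)) (k : ℤ) :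
    ∑ m ∈ Finset.range r, f (m + k) = ∑ m ∈ Finset.range r, f m := by
  have step (k : ℤ) :
      ∑ m ∈ Finset.range r, f (m + (k + 1)) = ∑ m ∈ Finset.range r, f (m + k) := by
    have h := (Finset.sum_range_succ' (fun m : ℕ => f (m + k)) r).symm.trans
      (Finset.sum_range_succ (fun m : ℕ => f (m + k)) r)
    have hp : f ((r : ℤ) + k) = f (((0 : ℕ) : ℤ) + k) := by
      rw [add_comm, hf k, Nat.cast_zero, zero_add]
    rw [hp] at h
    rw [← add_right_cancel h]
    refine Finset.sum_congr rfl fun m _ => congrArg f ?_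
    push_cast
    ring
  induction k using Int.induction_on with
  | zero => simp
  | succ i ih => rw [step, ih]
  | pred i ih => rw [← ih, ← step, sub_add_cancel]

theorem IsPrimitiveRoot.zpow_eq_zpow_of_dvd_sub {K : Type*} [Field K] {ξ : K} {r : ℕ}
    (hξ : IsPrimitiveRoot ξ r) (h0 : ξ ≠ 0) {a c : ℤ} (h : (r : ℤ) ∣ a - c) :
    ξ ^ a = ξ ^ c := by
  rw [← sub_add_cancel a c, zpow_add₀ h0, (hξ.zpow_eq_one_iff_dvd _).2 h, one_mul]

/-- Completing the square in a quadratic Gauss sum with a linear term. -/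
theorem IsPrimitiveRoot.sum_zpow_mul_succ_add_linear {K : Type*} [Field K] {ξ : K} {r : ℕ}
    (hξ : IsPrimitiveRoot ξ r) (h0 : ξ ≠ 0) {b s β : ℤ} (hs : s ^ 2 = 1)
    (hβ : (r : ℤ) ∣ β * b - 1) :
    ∑ m ∈ Finset.range r, ξ ^ (b * ((m : ℤ) * (m + 1)) + s * (2 * m + 1)) =
      (∑ m ∈ Finset.range r, ξ ^ (b * ((m : ℤ) * (m + 1)))) * ξ ^ (-β) := by
  have hp : Function.Periodic (fun m : ℤ => ξ ^ (b * (m * (m + 1)))) (r : ℤ) := fun m =>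
    hξ.zpow_eq_zpow_of_dvd_sub h0 ⟨b * (2 * m + 1 + r), by ring⟩
  rw [← sum_range_add_int_of_periodic _ r hp (s * β), Finset.sum_mul]
  refine Finset.sum_congr rfl fun m _ => ?_
  rw [← zpow_add₀ h0]
  refine hξ.zpow_eq_zpow_of_dvd_sub h0 ?_
  obtain ⟨q, hq⟩ := hβ
  refine ⟨-q * (s * (2 * m + 1) + β), ?_⟩
  linear_combination (-(s * (2 * (m : ℤ) + 1) + β)) * hq - b * β ^ 2 * hs

theorem IsPrimitiveRoot.sum_zpow_mul_succ_add_linear_eq_zero {K : Type*} [Field K] {ξ : K}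
    {r : ℕ} (hξ : IsPrimitiveRoot ξ r) (h0 : ξ ≠ 0) {b s d : ℤ} (hd : (r : ℤ) ∣ b * d)
    (hsd : ¬ (r : ℤ) ∣ s * (2 * d)) :
    ∑ m ∈ Finset.range r, ξ ^ (b * ((m : ℤ) * (m + 1)) + s * (2 * m + 1)) = 0 := by
  have hp : Function.Periodic
      (fun m : ℤ => ξ ^ (b * (m * (m + 1)) + s * (2 * m + 1))) (r : ℤ) := fun m =>
    hξ.zpow_eq_zpow_of_dvd_sub h0 ⟨b * (2 * m + 1 + r) + 2 * s, by ring⟩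
  have h := sum_range_add_int_of_periodic _ r hp d
  have hshift : ∑ m ∈ Finset.range r,
      ξ ^ (b * (((m : ℤ) + d) * (m + d + 1)) + s * (2 * (m + d) + 1)) =
      (∑ m ∈ Finset.range r, ξ ^ (b * ((m : ℤ) * (m + 1)) + s * (2 * m + 1))) *
        ξ ^ (s * (2 * d)) := by
    rw [Finset.sum_mul]
    refine Finset.sum_congr rfl fun m _ => ?_
    rw [← zpow_add₀ h0]
    obtain ⟨q, hq⟩ := hd
    exact hξ.zpow_eq_zpow_of_dvd_sub h0
      ⟨q * (2 * m + 1 + d), by linear_combination (2 * (m : ℤ) + 1 + d) * hq⟩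
  by_contra hne
  exact hsd ((hξ.zpow_eq_one_iff_dvd _).1
    ((mul_eq_left₀ hne).1 (hshift.symm.trans h)))

theorem stmt_17 (r : ℕ) (hr : Odd r) (hr0 : 0 < r) (ξ : ℂ)
    (hξ : IsPrimitiveRoot ξ r) (b : ℤ) (hb : b ≠ 0) (β : ℤ)
    (hβ : Int.gcd b r = 1 → β * b ≡ 1 [ZMOD (r : ℤ)]) :
    (Int.gcd b r = 1 →
      ∑ n ∈ (Finset.range (2 * r)).filter (fun n => Odd n),
          ξ ^ (b * (((n : ℤ) ^ 2 - 1) / 4)) * (ξ ^ (n : ℤ) + ξ ^ (-(n : ℤ)) - 2) =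
        -2 * (∑ n ∈ (Finset.range (2 * r)).filter (fun n => Odd n),
                ξ ^ (b * (((n : ℤ) ^ 2 - 1) / 4))) * (1 - ξ ^ (-β))) ∧
    (1 < Int.gcd b r →
      ∑ n ∈ (Finset.range (2 * r)).filter (fun n => Odd n),
          ξ ^ (b * (((n : ℤ) ^ 2 - 1) / 4)) * (ξ ^ (n : ℤ) + ξ ^ (-(n : ℤ)) - 2) =
        -2 * ∑ n ∈ (Finset.range (2 * r)).filter (fun n => Odd n),
              ξ ^ (b * (((n : ℤ) ^ 2 - 1) / 4))) := by
  have h0 : ξ ≠ 0 := hξ.ne_zero hr0.ne'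
  have hexp (m : ℕ) : (((2 * m + 1 : ℕ) : ℤ) ^ 2 - 1) / 4 = (m : ℤ) * (m + 1) :=
    Int.ediv_eq_of_eq_mul_right (by norm_num) (by push_cast; ring)
  have hsplit : ∑ m ∈ Finset.range r, ξ ^ (b * ((m : ℤ) * (m + 1))) *
      (ξ ^ ((2 * m + 1 : ℕ) : ℤ) + ξ ^ (-((2 * m + 1 : ℕ) : ℤ)) - 2) =
      ∑ m ∈ Finset.range r, ξ ^ (b * ((m : ℤ) * (m + 1)) + 1 * (2 * m + 1)) +
      ∑ m ∈ Finset.range r, ξ ^ (b * ((m : ℤ) * (m + 1)) + (-1) * (2 * m + 1)) -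
      2 * ∑ m ∈ Finset.range r, ξ ^ (b * ((m : ℤ) * (m + 1))) := by
    rw [Finset.mul_sum, ← Finset.sum_add_distrib, ← Finset.sum_sub_distrib]
    refine Finset.sum_congr rfl fun m _ => ?_
    rw [zpow_add₀ h0, zpow_add₀ h0, one_mul, neg_one_mul]
    push_cast
    ring
  simp only [sum_filter_odd_range_two_mul, hexp, hsplit]
  refine ⟨fun hc => ?_, fun hc => ?_⟩
  · have hβ' := (hβ hc).symm.dvd
    rw [hξ.sum_zpow_mul_succ_add_linear h0 (by norm_num) hβ',
      hξ.sum_zpow_mul_succ_add_linear h0 (by norm_num) hβ']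
    ring
  · obtain ⟨d, hd⟩ : (Int.gcd b r : ℤ) ∣ r := Int.gcd_dvd_right ..
    obtain ⟨a, ha⟩ : (Int.gcd b r : ℤ) ∣ b := Int.gcd_dvd_left ..
    generalize Int.gcd b r = c at hc hd ha
    have hc' : (1 : ℤ) < c := by exact_mod_cast hc
    have hr' : (0 : ℤ) < r := by exact_mod_cast hr0
    have hd0 : 0 < d := by
      rw [hd] at hr'
      exact pos_of_mul_pos_right hr' (by positivity)
    have hbd : (r : ℤ) ∣ b * d := ⟨a, by rw [hd, ha]; ring⟩
    have h2d : ¬ (r : ℤ) ∣ 2 * d := fun h => by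
      have hcop : IsCoprime (r : ℤ) 2 := by
        exact_mod_cast Nat.isCoprime_iff_coprime.2 hr.coprime_two_right
      have := Int.le_of_dvd hd0 (hcop.dvd_of_dvd_mul_left h)
      nlinarith
    rw [hξ.sum_zpow_mul_succ_add_linear_eq_zero h0 hbd (by rwa [one_mul]),
      hξ.sum_zpow_mul_succ_add_linear_eq_zero h0 hbd (by rwa [neg_one_mul, dvd_neg])]
    ring
end

section
/- Let b be a positive integer, let n₁, …, n_s be pairwise distinct positive integers each coprime to b, and let k₁, …, k_s ≥ 1 be integers. Then the ring endomorphism of ℤ[1/b][q]/(Φ_{n₁}(q)^{k₁} ⋯ Φ_{n_s}(q)^{k_s}) induced by q ↦ q^b is well defined and bijective, i.e., a ring isomorphism. -/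
open Polynomial

/-- If `n` and `b` are coprime, the `n`-th cyclotomic polynomial `Φₙ(X)` divides `Φₙ(X ^ b)`. -/
theorem cyclotomic_dvd_expand_of_coprime (R : Type*) [CommRing R] {n b : ℕ} (hn : 0 < n)
    (h : Nat.Coprime n b) : cyclotomic n R ∣ expand R b (cyclotomic n R) := by
  have hZ : cyclotomic n ℤ ∣ expand ℤ b (cyclotomic n ℤ) := by
    have hζ := Complex.isPrimitiveRoot_exp n hn.ne'
    rw [cyclotomic_eq_minpoly hζ hn]
    refine minpoly.isIntegrallyClosed_dvd (hζ.isIntegral hn) ?_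
    rw [expand_aeval, ← cyclotomic_eq_minpoly hζ hn, aeval_def, eval₂_eq_eval_map, map_cyclotomic]
    exact (hζ.pow_of_coprime b h.symm).isRoot_cyclotomic hn
  have := Polynomial.map_dvd (Int.castRingHom R) hZ
  rwa [map_expand, map_cyclotomic] at this

/-- `X ^ m - 1` divides `X ^ n - 1` when `m` divides `n`. -/
theorem X_pow_sub_one_dvd_X_pow_sub_one (R : Type*) [CommRing R] {m n : ℕ} (h : m ∣ n) :
    (X ^ m - 1 : R[X]) ∣ X ^ n - 1 := by
  obtain ⟨c, rfl⟩ := h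
  simpa [pow_mul] using sub_dvd_pow_sub_pow (X ^ m : R[X]) 1 c

/-- Suppose `x ^ N - 1` is nilpotent, `b` is invertible and prime to `N`. Then a ring endomorphism
mapping `x` to `x ^ b` has `x` in its range. -/
theorem exists_map_eq_of_map_eq_pow {A : Type*} [CommRing A] (F : A →+* A) {x : A} {b N : ℕ}
    (hN : 0 < N) (hb0 : 0 < b) (hb : IsUnit (b : A)) (hNb : Nat.Coprime N b)
    (hx : IsNilpotent (x ^ N - 1))
    (hF : F x = x ^ b) : ∃ r, F r = x := by
  have hxu : IsUnit x := by
    have h : IsUnit (x ^ N) := by simpa using hx.isUnit_one_add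
    exact (isUnit_pow_iff hN.ne').1 h
  obtain ⟨c, m, hcm⟩ : ∃ c m : ℕ, c * b = 1 + N * m := by
    have hφ : 0 < Nat.totient N := Nat.totient_pos.2 hN
    have h1 : b ^ (Nat.totient N - 1) * b ≡ 1 [MOD N] := by
      rw [pow_sub_one_mul hφ.ne']
      exact Nat.ModEq.pow_totient hNb.symm
    have hpos : 0 < b ^ (Nat.totient N - 1) * b := by positivity
    obtain ⟨m, hm⟩ := (Nat.modEq_iff_dvd' hpos).1 h1.symm
    exact ⟨b ^ (Nat.totient N - 1), m, by omega⟩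
  have hnil : IsNilpotent (x ^ (c * b) - x) := by
    have h : x ^ (c * b) - x = (x ^ N - 1) * (x * ∑ i ∈ Finset.range m, (x ^ N) ^ i) := by
      rw [hcm, pow_add, pow_mul]
      linear_combination (-x) * mul_geom_sum (x ^ N) m
    rw [h]
    exact (Commute.all _ _).isNilpotent_mul_right hx
  have hder (a z : A) (hz : IsUnit z) : IsUnit (aeval z (derivative (X ^ b - C a))) := by
    simpa [derivative_X_pow] using And.intro hb (hz.pow (b - 1))
  obtain ⟨r, ⟨hr, hrx⟩, -⟩ := existsUnique_nilpotent_sub_and_aeval_eq_zero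
    (P := X ^ b - C x) (x := x ^ c) (by simpa [← pow_mul] using hnil) (hder _ _ (hxu.pow c))
  have hrx' : r ^ b = x := by simpa [sub_eq_zero] using hrx
  obtain ⟨z, -, hz⟩ := existsUnique_nilpotent_sub_and_aeval_eq_zero
    (P := X ^ b - C (x ^ b)) (x := x) (by simp) (hder _ _ hxu)
  refine ⟨r, (hz (F r) ⟨?_, ?_⟩).trans (hz x ⟨by simp, by simp⟩).symm⟩
  · have h : x - F r = F (x ^ c - r) - (x ^ (c * b) - x) := by
      rw [map_sub, map_pow, hF, ← pow_mul, mul_comm b]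
      ring
    rw [h]
    exact (Commute.all _ _).isNilpotent_sub (hr.map F) hnil
  · simp [← map_pow, hrx', hF]

theorem stmt_18 (b s : ℕ) (hb : 0 < b) (n : Fin s → ℕ) (k : Fin s → ℕ)
    (hn_pos : ∀ i, 0 < n i) (hn_inj : Function.Injective n)
    (hcop : ∀ i, Nat.Coprime (n i) b) (hk : ∀ i, 1 ≤ k i)
    (R : Type) [CommRing R] [Algebra ℤ R] [IsLocalization.Away (b : ℤ) R] :
    (∃ F : (R[X] ⧸ Ideal.span {∏ i, (cyclotomic (n i) R) ^ (k i)}) →+*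
           (R[X] ⧸ Ideal.span {∏ i, (cyclotomic (n i) R) ^ (k i)}),
        F (Ideal.Quotient.mk (Ideal.span {∏ i, (cyclotomic (n i) R) ^ (k i)}) X) =
          Ideal.Quotient.mk (Ideal.span {∏ i, (cyclotomic (n i) R) ^ (k i)}) (X ^ b)) ∧
    (∀ F : (R[X] ⧸ Ideal.span {∏ i, (cyclotomic (n i) R) ^ (k i)}) →+*
           (R[X] ⧸ Ideal.span {∏ i, (cyclotomic (n i) R) ^ (k i)}),
        F (Ideal.Quotient.mk (Ideal.span {∏ i, (cyclotomic (n i) R) ^ (k i)}) X) =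
          Ideal.Quotient.mk (Ideal.span {∏ i, (cyclotomic (n i) R) ^ (k i)}) (X ^ b) →
        Function.Bijective F) := by
  set P : R[X] := ∏ i, (cyclotomic (n i) R) ^ (k i) with hP
  have hle : Ideal.span {P} ≤ (Ideal.span {P}).comap (expand R b : R[X] →+* R[X]) := by
    rw [Ideal.span_singleton_le_iff_mem, Ideal.mem_comap, Ideal.mem_span_singleton]
    simp only [hP, RingHom.coe_coe, map_prod, map_pow]
    exact Finset.prod_dvd_prod_of_dvd _ _ fun i _ =>
      pow_dvd_pow_of_dvd (cyclotomic_dvd_expand_of_coprime R (hn_pos i) (hcop i)) _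
  refine ⟨⟨Ideal.quotientMap _ _ hle, by simp [Ideal.quotientMap_mk]⟩, fun F hF => ?_⟩
  have hfin : Module.Finite R (R[X] ⧸ Ideal.span {P}) :=
    (monic_prod_of_monic _ _ fun i _ => (cyclotomic.monic (n i) R).pow (k i)).finite_quotient
  have hbR : IsUnit (b : R) := by
    simpa using IsLocalization.Away.algebraMap_isUnit (S := R) (b : ℤ)
  have hC (a : R) : F (Ideal.Quotient.mk _ (C a)) = Ideal.Quotient.mk _ (C a) := by
    have h : F.comp ((Ideal.Quotient.mk (Ideal.span {P})).comp C) =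
        (Ideal.Quotient.mk (Ideal.span {P})).comp C :=
      IsLocalization.ringHom_ext (Submonoid.powers (b : ℤ)) (RingHom.ext_int _ _)
    exact RingHom.congr_fun h a
  have hdvd : P ∣ (X ^ (∏ i, n i) - 1) ^ (∑ i, k i) := by
    rw [hP, ← Finset.prod_pow_eq_pow_sum]
    exact Finset.prod_dvd_prod_of_dvd _ _ fun i _ => pow_dvd_pow_of_dvd
      ((cyclotomic.dvd_X_pow_sub_one _ _).trans
        (X_pow_sub_one_dvd_X_pow_sub_one R (Finset.dvd_prod_of_mem n (Finset.mem_univ i)))) _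
  obtain ⟨r, hr⟩ := exists_map_eq_of_map_eq_pow F (x := Ideal.Quotient.mk _ X) (b := b)
    (N := ∏ i, n i) (Finset.prod_pos fun i _ => hn_pos i) hb
    (by simpa using (hbR.map C).map (Ideal.Quotient.mk (Ideal.span {P})))
    (Nat.Coprime.prod_left fun i _ => hcop i)
    ⟨∑ i, k i, by
      simpa using Ideal.Quotient.eq_zero_iff_mem.2 (Ideal.mem_span_singleton.2 hdvd)⟩
    (by simpa using hF)
  have hsurj : Function.Surjective F := by
    rw [← RingHom.range_eq_top, eq_top_iff]
    rintro y -
    obtain ⟨p, rfl⟩ := Ideal.Quotient.mk_surjective y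
    induction p using Polynomial.induction_on with
    | C a => exact ⟨_, hC a⟩
    | add p q hp hq => rw [map_add]; exact add_mem hp hq
    | monomial m a _ =>
      rw [map_mul, map_pow]
      exact mul_mem (RingHom.mem_range.2 ⟨_, hC a⟩) (pow_mem (RingHom.mem_range.2 ⟨r, hr⟩) _)
  let f : (R[X] ⧸ Ideal.span {P}) →ₐ[R] (R[X] ⧸ Ideal.span {P}) := { F with commutes' := hC }
  exact ⟨OrzechProperty.injective_of_surjective_endomorphism f.toLinearMap hsurj, hsurj⟩
end
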